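/- Let α ∈ (0,1/2), let γ be an integer with γ > (3α−1)/(1−2α), let (1−α)/k_γ < C₁ < C₂ < 1, and let (n_i) be a strictly increasing sequence of positive integers with integers a_i ≥ 1 satisfying C₁·k_γ·f(n_i) ≤ a_i + (γ+1)(4^{a_i}−1)/3 ≤ C₂·k_γ·f(n_i) for every i. For a graph G let W̃(a)(G) be the number of induced copies F of W_a^γ in G such that every vertex of G outside F has a neighbor in F. Then E[W̃(a_i)(G(n_i, n_i^{−α}))] → ∞ as i → ∞. -/

import Mathlib

open Filter FirstOrder

noncomputable section

/-! ### The binomial random graph `G(n,p)` -/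

/-- The number of edges of a simple graph. -/
noncomputable def edgeCt {n : ℕ} (G : SimpleGraph (Fin n)) : ℕ := Nat.card G.edgeSet

open scoped Classical in
/-- `prob n p Q` is the probability that the binomial random graph `G(n,p)` (on vertex set
`Fin n`) has property `Q`: the sum over all graphs `G` with `Q G` of
`p^{e(G)} (1-p)^{n(n-1)/2 - e(G)}`. -/
noncomputable def prob (n : ℕ) (p : ℝ) (Q : SimpleGraph (Fin n) → Prop) : ℝ :=
  ∑ G : SimpleGraph (Fin n),
    if Q G then p ^ edgeCt G * (1 - p) ^ (n * (n - 1) / 2 - edgeCt G) else 0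

/-- `expec n p W` is the expectation of a real-valued function `W` of the binomial random
graph `G(n,p)`. -/
noncomputable def expec (n : ℕ) (p : ℝ) (W : SimpleGraph (Fin n) → ℝ) : ℝ :=
  ∑ G : SimpleGraph (Fin n),
    W G * (p ^ edgeCt G * (1 - p) ^ (n * (n - 1) / 2 - edgeCt G))

/-! ### The graphs `W_a^γ` and `W_a^{γ,*}` -/

/-- `ωr r a = (r^a − 1)/(r−1)`, the number of vertices of the perfect `r`-ary tree of
depth `a − 1`. -/
def ωr (r a : ℕ) : ℕ := (r ^ a - 1) / (r - 1)

/-- The depth of the node with (0-based) breadth-first (heap) index `j` in the infinite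
`r`-ary tree: the root has index 0, and the parent of node `j ≥ 1` is node `(j−1)/r`. -/
def heapDepth (r : ℕ) : ℕ → ℕ
  | 0 => 0
  | j + 1 => heapDepth r (j / r) + 1
  decreasing_by exact Nat.lt_succ_of_le (Nat.div_le_self _ _)

/-- The vertex set of `W_a^γ`: the path `F₁` on `a` vertices (`Sum.inl`), together with,
for each of the `(4^a−1)/3` vertices `i` of the perfect 4-ary tree `F₂` (in breadth-first
order), the vertex `(i,0)` of `F₂` itself and the `γ` inner vertices `(i,1),…,(i,γ)` of the
path `P_{γ+2}` joining `i` to the vertex of `F₁` at the same distance from the root. -/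
abbrev WVert (γ a : ℕ) := Fin a ⊕ (Fin (ωr 4 a) × Fin (γ + 1))

/-- Base (directed) adjacency relation generating `W_a^γ`: consecutive `F₁`-vertices;
the last inner path vertex `(i,γ)` is joined to the `F₁`-vertex at depth of `i`;
consecutive vertices along each `P_{γ+2}`; and tree edges of the perfect 4-ary tree
(in heap indexing, `j` is the parent of `i ≥ 1` iff `j = (i−1)/4`). -/
def Wbase (γ a : ℕ) : WVert γ a → WVert γ a → Prop
  | Sum.inl u, Sum.inl v => (v : ℕ) = (u : ℕ) + 1
  | Sum.inl u, Sum.inr iv => (iv.2 : ℕ) = γ ∧ heapDepth 4 (iv.1 : ℕ) = (u : ℕ)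
  | Sum.inr _, Sum.inl _ => False
  | Sum.inr iv, Sum.inr jw =>
      (iv.1 = jw.1 ∧ (jw.2 : ℕ) = (iv.2 : ℕ) + 1) ∨
      ((iv.2 : ℕ) = 0 ∧ (jw.2 : ℕ) = 0 ∧ 1 ≤ (iv.1 : ℕ) ∧ (jw.1 : ℕ) = ((iv.1 : ℕ) - 1) / 4)

/-- The graph `W_a^γ`. -/
def WG (γ a : ℕ) : SimpleGraph (WVert γ a) := SimpleGraph.fromRel (Wbase γ a)

/-- The vertex set of `W_a^{γ,*}` (with `ω₁ = ωr r a`, `ω₂ = ωr r ω₁`), as five pieces: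
the path `F₁` on `a` vertices; the tree `F₂` together with the inner vertices of the
paths `P_{γ+2}` joining `F₂` to `F₁` (pairs `(i,k)`, `k = 0` being the `F₂`-vertex itself);
the `γ` inner vertices of the paths `P_{γ+2}` joining the `i`-th vertex of `F₂` (in
breadth-first order) to the `i`-th vertex of the path `F̃₁`; the path `F̃₁` on `ω₁`
vertices; and the tree `F̃₂` together with the inner vertices of the paths `P_{γ+2}`
joining `F̃₂` to `F̃₁`. -/
abbrev WSVert (γ r a : ℕ) :=
  Fin a ⊕ ((Fin (ωr r a) × Fin (γ + 1)) ⊕ ((Fin (ωr r a) × Fin γ) ⊕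
    (Fin (ωr r a) ⊕ (Fin (ωr r (ωr r a)) × Fin (γ + 1)))))

/-- Base (directed) adjacency relation generating `W_a^{γ,*}`. -/
def WSbase (γ r a : ℕ) : WSVert γ r a → WSVert γ r a → Prop
  | .inl u, .inl v => (v : ℕ) = (u : ℕ) + 1
  | .inl u, .inr (.inl iv) => (iv.2 : ℕ) = γ ∧ heapDepth r (iv.1 : ℕ) = (u : ℕ)
  | .inr (.inl iv), .inr (.inl jw) =>
      (iv.1 = jw.1 ∧ (jw.2 : ℕ) = (iv.2 : ℕ) + 1) ∨
      ((iv.2 : ℕ) = 0 ∧ (jw.2 : ℕ) = 0 ∧ 1 ≤ (iv.1 : ℕ) ∧ (jw.1 : ℕ) = ((iv.1 : ℕ) - 1) / r)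
  | .inr (.inl iv), .inr (.inr (.inl jm)) => (iv.2 : ℕ) = 0 ∧ iv.1 = jm.1 ∧ (jm.2 : ℕ) = 0
  | .inr (.inl iv), .inr (.inr (.inr (.inl d))) => γ = 0 ∧ (iv.2 : ℕ) = 0 ∧ (iv.1 : ℕ) = (d : ℕ)
  | .inr (.inr (.inl im)), .inr (.inr (.inl jm)) => im.1 = jm.1 ∧ (jm.2 : ℕ) = (im.2 : ℕ) + 1
  | .inr (.inr (.inl im)), .inr (.inr (.inr (.inl d))) =>
      (im.2 : ℕ) + 1 = γ ∧ (im.1 : ℕ) = (d : ℕ)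
  | .inr (.inr (.inr (.inl d))), .inr (.inr (.inr (.inl e))) => (e : ℕ) = (d : ℕ) + 1
  | .inr (.inr (.inr (.inl d))), .inr (.inr (.inr (.inr jw))) =>
      (jw.2 : ℕ) = γ ∧ heapDepth r (jw.1 : ℕ) = (d : ℕ)
  | .inr (.inr (.inr (.inr iv))), .inr (.inr (.inr (.inr jw))) =>
      (iv.1 = jw.1 ∧ (jw.2 : ℕ) = (iv.2 : ℕ) + 1) ∨
      ((iv.2 : ℕ) = 0 ∧ (jw.2 : ℕ) = 0 ∧ 1 ≤ (iv.1 : ℕ) ∧ (jw.1 : ℕ) = ((iv.1 : ℕ) - 1) / r)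
  | _, _ => False

/-- The graph `W_a^{γ,*}`. -/
def WSG (γ r a : ℕ) : SimpleGraph (WSVert γ r a) := SimpleGraph.fromRel (WSbase γ r a)

/-- `Vnum γ r a = V_{γ,r}(a) = a + 2(γ+1)ω_r(a) + (γ+1)ω_r(ω_r(a))`,
the number of vertices of `W_a^{γ,*}`. -/
def Vnum (γ r a : ℕ) : ℕ := a + 2 * (γ + 1) * ωr r a + (γ + 1) * ωr r (ωr r a)

/-- `s` is (the vertex set of) an induced copy of `H` in `G`. -/
def IsInducedCopy {V W : Type} (H : SimpleGraph W) (G : SimpleGraph V) (s : Set V) : Prop :=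
  Nonempty (H ≃g G.induce s)

/-! ### The quantities `k_γ` and `f` -/

/-- `kcoef α γ = k_γ = 2(1 − α(γ+2)/(γ+1))`. -/
def kcoef (α : ℝ) (γ : ℕ) : ℝ := 2 * (1 - α * ((γ : ℝ) + 2) / ((γ : ℝ) + 1))

/-- `ff α x = f(x) = x^α · ln x`. -/
def ff (α x : ℝ) : ℝ := x ^ α * Real.log x

/-! ### The language `L_m` and EMSO satisfaction -/

/-- Relation symbols of the language `L_m`: `m` unary symbols and one binary symbol. -/
def LRel (m : ℕ) : ℕ → Type
  | 1 => Fin m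
  | 2 => Unit
  | _ => Empty

/-- The first-order language `L_m`: one binary relation symbol, `m` unary relation symbols
and no function symbols. -/
def Lang (m : ℕ) : Language where
  Functions := fun _ => Empty
  Relations := LRel m

/-- The `L_m`-structure on `Fin n` whose binary relation is adjacency in the graph `G` and
whose `i`-th unary relation is membership in `S i`. -/
def structOf {n m : ℕ} (G : SimpleGraph (Fin n)) (S : Fin m → Set (Fin n)) :
    (Lang m).Structure (Fin n) where
  funMap := fun f _ => Empty.elim f
  RelMap := fun {k} r v =>
    match k, r, v with
    | 1, i, v => v 0 ∈ S i
    | 2, _, v => G.Adj (v 0) (v 1)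
    | 0, r, _ => Empty.elim r
    | (_ + 3), r, _ => Empty.elim r

/-- `G` EMSO-satisfies the `L_m`-sentence `φ`: there are sets `S 0, …, S (m-1)` of vertices
such that the structure on `Fin n` given by adjacency in `G` and membership in the `S i`
satisfies `φ`. -/
def EMSOSat {n m : ℕ} (G : SimpleGraph (Fin n)) (φ : (Lang m).Sentence) : Prop :=
  ∃ S : Fin m → Set (Fin n),
    @FirstOrder.Language.Sentence.Realize (Lang m) (Fin n) (structOf G S) φ

/-- `W̃(a)(G)`: the number of induced copies `F` of `W_a^γ` in `G` such that every vertex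
of `G` outside `F` has a neighbor in `F`. -/
noncomputable def maxCopyCount (γ a : ℕ) {n : ℕ} (G : SimpleGraph (Fin n)) : ℕ :=
  Nat.card {s : Set (Fin n) // IsInducedCopy (WG γ a) G s ∧ ∀ v ∉ s, ∃ u ∈ s, G.Adj v u}

open scoped Classical in
/-- Expanding a product over all pairs of vertices as a sum over graphs. -/
theorem sum_graph_prod_ite {n : ℕ} (A B : Sym2 (Fin n) → ℝ) :
    ∑ G : SimpleGraph (Fin n), ∏ e ∈ (⊤ : SimpleGraph (Fin n)).edgeFinset,
      (if e ∈ G.edgeSet then A e else B e) =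
    ∏ e ∈ (⊤ : SimpleGraph (Fin n)).edgeFinset, (A e + B e) := by
  rw [Finset.prod_add]
  refine Finset.sum_bij' (fun G _ => G.edgeFinset)
    (fun t _ => SimpleGraph.fromEdgeSet (t : Set (Sym2 (Fin n)))) ?_ ?_ ?_ ?_ ?_
  · intro G _
    rw [Finset.mem_powerset]
    exact SimpleGraph.edgeFinset_mono le_top
  · intros; exact Finset.mem_univ _
  · intro G _
    simp
  · intro t ht
    ext e
    rw [Finset.mem_powerset] at ht
    simp only [SimpleGraph.mem_edgeFinset, SimpleGraph.edgeSet_fromEdgeSet, Set.mem_sdiff,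
      Finset.mem_coe]
    constructor
    · exact fun h => h.1
    · intro h
      refine ⟨h, ?_⟩
      have := ht h
      simpa using this
  · intro G _
    rw [Finset.prod_ite]
    congr 1
    · apply Finset.prod_congr _ (fun _ _ => rfl)
      ext e
      simp only [Finset.mem_filter, SimpleGraph.mem_edgeFinset]
      exact ⟨fun h => h.2, fun h => ⟨SimpleGraph.edgeSet_mono le_top h, h⟩⟩
    · apply Finset.prod_congr _ (fun _ _ => rfl)
      ext e
      simp

open scoped Classical in
theorem graph_weight_eq_prod {n : ℕ} (p : ℝ) (G : SimpleGraph (Fin n)) :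
    p ^ edgeCt G * (1 - p) ^ (n * (n - 1) / 2 - edgeCt G) =
    ∏ e ∈ (⊤ : SimpleGraph (Fin n)).edgeFinset, (if e ∈ G.edgeSet then p else 1 - p) := by
  have hsub : G.edgeFinset ⊆ (⊤ : SimpleGraph (Fin n)).edgeFinset :=
    SimpleGraph.edgeFinset_mono le_top
  have hc : edgeCt G = G.edgeFinset.card := by
    rw [edgeCt, Nat.card_eq_fintype_card, SimpleGraph.edgeFinset_card]
  have h1 : (⊤ : SimpleGraph (Fin n)).edgeFinset.filter (· ∈ G.edgeSet) = G.edgeFinset := by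
    ext e
    simp only [Finset.mem_filter, SimpleGraph.mem_edgeFinset]
    exact ⟨fun h => h.2, fun h => ⟨SimpleGraph.edgeSet_mono le_top h, h⟩⟩
  have h2 : (⊤ : SimpleGraph (Fin n)).edgeFinset.filter (· ∉ G.edgeSet) =
      (⊤ : SimpleGraph (Fin n)).edgeFinset \ G.edgeFinset := by
    ext e
    simp
  rw [Finset.prod_ite, Finset.prod_const, Finset.prod_const, h1, h2,
    Finset.card_sdiff_of_subset hsub, SimpleGraph.card_edgeFinset_top_eq_card_choose_two, hc,
    Fintype.card_fin, Nat.choose_two_right]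

/-- `f` embeds `H` as an induced subgraph of `G`. -/
def IsInducedMap {V W : Type} (H : SimpleGraph W) (G : SimpleGraph V) (f : W → V) : Prop :=
  ∀ u v, G.Adj (f u) (f v) ↔ H.Adj u v

open scoped Classical in
/-- The factor which the pair `e` contributes to the probability of an induced copy of `H`
placed by `f`. -/
def pairWeight {V W : Type} (H : SimpleGraph W) (f : W → V) (p : ℝ) (e : Sym2 V) : ℝ :=
  (if ∀ d : Sym2 W, d.map f = e → d ∈ H.edgeSet then p else 0) +
  (if ∀ d : Sym2 W, d.map f = e → d ∉ H.edgeSet then 1 - p else 0)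

open scoped Classical in
theorem sum_graph_induced_avoid {n : ℕ} {W : Type} [Fintype W] (H : SimpleGraph W) (f : W ↪ Fin n)
    (p : ℝ) (T : Finset (Fin n)) (hT : ∀ v ∈ T, v ∉ Set.range f) :
    ∑ G : SimpleGraph (Fin n), (if IsInducedMap H G f then
      (∏ v ∈ T, if ∀ u, ¬ G.Adj v (f u) then (1 : ℝ) else 0) else 0) *
        (p ^ edgeCt G * (1 - p) ^ (n * (n - 1) / 2 - edgeCt G)) =
    (∏ e ∈ (⊤ : SimpleGraph (Fin n)).edgeFinset, pairWeight H f p e) *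
      ∏ _v ∈ T, (1 - p) ^ Fintype.card W := by
  set X : Finset (Sym2 (Fin n)) :=
    (T ×ˢ (Finset.univ : Finset W)).image (fun x => s(x.1, f x.2)) with hX
  have hXmem : ∀ v ∈ T, ∀ u, s(v, f u) ∈ X := fun v hv u => by
    rw [hX, Finset.mem_image]
    exact ⟨(v, u), by simp [hv], rfl⟩
  have hXnot : ∀ e ∈ X, ∀ d : Sym2 W, d.map f ≠ e := by
    intro e he d hd
    rw [hX, Finset.mem_image] at he
    obtain ⟨⟨v, u⟩, hvu, rfl⟩ := he
    have hv : v ∈ T := by simpa using hvu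
    have : v ∈ d.map f := by rw [hd]; simp
    rw [Sym2.mem_map] at this
    obtain ⟨w, -, hw⟩ := this
    exact hT v hv ⟨w, hw⟩
  have hXsub : X ⊆ (⊤ : SimpleGraph (Fin n)).edgeFinset := by
    intro e he
    rw [hX, Finset.mem_image] at he
    obtain ⟨⟨v, u⟩, hvu, rfl⟩ := he
    have hv : v ∈ T := by simpa using hvu
    simp only [SimpleGraph.mem_edgeFinset, SimpleGraph.mem_edgeSet, SimpleGraph.top_adj]
    exact fun h => hT v hv ⟨u, h.symm⟩
  have hXcard : X.card = T.card * Fintype.card W := by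
    rw [hX, Finset.card_image_of_injOn, Finset.card_product, Finset.card_univ]
    rintro ⟨v, u⟩ h1 ⟨v', u'⟩ h2 h
    have hv : v ∈ T := by simpa using h1
    have hv' : v' ∈ T := by simpa using h2
    simp only [Sym2.eq_iff] at h
    rcases h with ⟨h, h'⟩ | ⟨h, h'⟩
    · exact Prod.ext h (f.injective h')
    · exact absurd ⟨u', h.symm⟩ (hT v hv)
  set A : Sym2 (Fin n) → ℝ := fun e =>
    if (∀ d : Sym2 W, d.map f = e → d ∈ H.edgeSet) ∧ e ∉ X then p else 0 with hA
  set B : Sym2 (Fin n) → ℝ := fun e =>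
    if ∀ d : Sym2 W, d.map f = e → d ∉ H.edgeSet then 1 - p else 0 with hB
  have hAB : ∀ e, A e + B e = pairWeight H f p e * (if e ∈ X then 1 - p else 1) := by
    intro e
    by_cases he : e ∈ X
    · have h0 := hXnot e he
      simp [hA, hB, pairWeight, he, h0]
    · simp only [hA, hB, pairWeight, he, not_false_eq_true, and_true, if_false, mul_one]
      congr
  have hprod : ∏ e ∈ (⊤ : SimpleGraph (Fin n)).edgeFinset, (A e + B e) =
      (∏ e ∈ (⊤ : SimpleGraph (Fin n)).edgeFinset, pairWeight H f p e) *
      ∏ _v ∈ T, (1 - p) ^ Fintype.card W := by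
    simp_rw [hAB]
    rw [Finset.prod_mul_distrib, Finset.prod_ite, Finset.prod_const_one, mul_one,
      Finset.prod_const, Finset.prod_const, Finset.filter_mem_eq_inter,
      Finset.inter_eq_right.mpr hXsub, hXcard, ← pow_mul, mul_comm T.card]
  rw [← hprod, ← sum_graph_prod_ite]
  refine Finset.sum_congr rfl fun G _ => ?_
  rw [graph_weight_eq_prod]
  by_cases hI : IsInducedMap H G f
  · rw [if_pos hI]
    by_cases hN : ∀ v ∈ T, ∀ u, ¬ G.Adj v (f u)
    · rw [Finset.prod_eq_one, one_mul]
      · refine Finset.prod_congr rfl fun e _ => ?_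
        by_cases he : e ∈ G.edgeSet
        · rw [if_pos he, if_pos he, hA]
          refine (if_pos ⟨?_, ?_⟩).symm
          · rintro d rfl
            induction d with | _ x y =>
            exact (hI x y).1 he
          · intro heX
            rw [hX, Finset.mem_image] at heX
            obtain ⟨⟨v, u⟩, hvu, rfl⟩ := heX
            exact hN v (by simpa using hvu) u he
        · rw [if_neg he, if_neg he, hB]
          refine (if_pos ?_).symm
          rintro d rfl
          induction d with | _ x y =>
          exact fun h => he ((hI x y).2 h)
      · intro v hv
        exact if_pos (hN v hv)
    · push Not at hN
      obtain ⟨v, hv, u, hvu⟩ := hN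
      rw [Finset.prod_eq_zero hv, zero_mul]
      · symm
        apply Finset.prod_eq_zero (hXsub (hXmem v hv u))
        rw [if_pos (by exact hvu), hA]
        exact if_neg fun h => h.2 (hXmem v hv u)
      · exact if_neg fun h => h u hvu
  · rw [if_neg hI, zero_mul]
    symm
    rw [IsInducedMap] at hI
    push Not at hI
    obtain ⟨x, y, hxy⟩ := hI
    rcases hxy with ⟨h1, h2⟩ | ⟨h1, h2⟩
    · apply Finset.prod_eq_zero (i := s(f x, f y))
      · simpa using h1.ne
      · rw [if_pos (by exact h1), hA]
        exact if_neg fun h => h2 (h.1 s(x, y) rfl)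
    · apply Finset.prod_eq_zero (i := s(f x, f y))
      · simpa using h2.ne
      · rw [if_neg (by exact h1), hB]
        exact if_neg fun h => h s(x, y) rfl h2

open scoped Classical in
theorem sum_graph_induced_dominating {n : ℕ} {W : Type} [Fintype W] (H : SimpleGraph W)
    (f : W ↪ Fin n) (p : ℝ) :
    ∑ G : SimpleGraph (Fin n),
      (if IsInducedMap H G f ∧ ∀ v ∉ Set.range f, ∃ u, G.Adj v (f u) then (1 : ℝ) else 0) *
        (p ^ edgeCt G * (1 - p) ^ (n * (n - 1) / 2 - edgeCt G)) =
    (∏ e ∈ (⊤ : SimpleGraph (Fin n)).edgeFinset, pairWeight H f p e) *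
      (1 - (1 - p) ^ Fintype.card W) ^ (n - Fintype.card W) := by
  set S : Finset (Fin n) := Finset.univ.filter (· ∉ Set.range f) with hS
  have hScard : S.card = n - Fintype.card W := by
    have h1 : S = (Finset.univ.image f)ᶜ := by
      ext v
      simp [hS]
    rw [h1, Finset.card_compl, Finset.card_image_of_injective _ f.injective, Finset.card_univ,
      Fintype.card_fin]
  have hind : ∀ G : SimpleGraph (Fin n),
      (if IsInducedMap H G f ∧ ∀ v ∉ Set.range f, ∃ u, G.Adj v (f u) then (1 : ℝ) else 0) =
      ∑ T ∈ S.powerset, (∏ _v ∈ T, (-1 : ℝ)) * (if IsInducedMap H G f then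
        (∏ v ∈ T, if ∀ u, ¬ G.Adj v (f u) then (1 : ℝ) else 0) else 0) := by
    intro G
    by_cases hI : IsInducedMap H G f
    · simp only [hI, true_and, if_true]
      simp_rw [← Finset.prod_mul_distrib]
      rw [← Finset.prod_one_add]
      by_cases hD : ∀ v ∉ Set.range f, ∃ u, G.Adj v (f u)
      · rw [if_pos hD, Finset.prod_eq_one]
        intro v hv
        obtain ⟨u, hu⟩ := hD v (by simpa [hS] using hv)
        rw [if_neg (fun h => h u hu)]
        norm_num
      · rw [if_neg hD]
        push Not at hD
        obtain ⟨v, hv, hu⟩ := hD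
        rw [Finset.prod_eq_zero (i := v)]
        · simpa [hS] using hv
        · rw [if_pos hu]
          norm_num
    · simp [hI]
  simp_rw [hind, Finset.sum_mul, mul_assoc]
  rw [Finset.sum_comm]
  simp_rw [← Finset.mul_sum]
  have hT : ∀ T ∈ S.powerset, (∏ _v ∈ T, (-1 : ℝ)) * ∑ G : SimpleGraph (Fin n),
      (if IsInducedMap H G f then
      (∏ v ∈ T, if ∀ u, ¬ G.Adj v (f u) then (1 : ℝ) else 0) else 0) *
        (p ^ edgeCt G * (1 - p) ^ (n * (n - 1) / 2 - edgeCt G)) =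
      (∏ e ∈ (⊤ : SimpleGraph (Fin n)).edgeFinset, pairWeight H f p e) *
        ∏ _v ∈ T, (-(1 - p) ^ Fintype.card W) := by
    intro T hT
    rw [sum_graph_induced_avoid H f p T]
    · rw [mul_left_comm, ← Finset.prod_mul_distrib]
      simp
    · intro v hv
      have := Finset.mem_powerset.1 hT hv
      simpa [hS] using this
  rw [Finset.sum_congr rfl hT, ← Finset.mul_sum, ← Finset.prod_one_add, Finset.prod_const, hScard,
    ← sub_eq_add_neg]

open scoped Classical in
theorem le_prod_pairWeight {n : ℕ} {W : Type} [Fintype W] (H : SimpleGraph W) (f : W ↪ Fin n)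
    {p : ℝ} (hp0 : 0 ≤ p) (hp1 : p ≤ 1) {m : ℕ} (hm : H.edgeFinset.card ≤ m) :
    p ^ m * (1 - p) ^ (Fintype.card W).choose 2 ≤
      ∏ e ∈ (⊤ : SimpleGraph (Fin n)).edgeFinset, pairWeight H f p e := by
  have hq0 : 0 ≤ 1 - p := by linarith
  have hq1 : 1 - p ≤ 1 := by linarith
  set X := H.edgeFinset.image (Sym2.map f) with hX
  set Y := (⊤ : SimpleGraph W).edgeFinset.image (Sym2.map f) with hY
  have hXc : X.card ≤ m := Finset.card_image_le.trans hm
  have hYc : Y.card ≤ (Fintype.card W).choose 2 := by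
    rw [← SimpleGraph.card_edgeFinset_top_eq_card_choose_two]
    exact Finset.card_image_le
  have hle : ∀ e ∈ (⊤ : SimpleGraph (Fin n)).edgeFinset,
      (if e ∈ X then p else 1) * (if e ∈ Y then 1 - p else 1) ≤ pairWeight H f p e := by
    intro e he
    have hprod : (if e ∈ X then p else 1) * (if e ∈ Y then 1 - p else 1) ≤
        (if e ∈ X then p else 1) := by
      apply mul_le_of_le_one_right <;> split_ifs <;> linarith
    have hprod' : (if e ∈ X then p else 1) * (if e ∈ Y then 1 - p else 1) ≤
        (if e ∈ Y then 1 - p else 1) := by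
      apply mul_le_of_le_one_left <;> split_ifs <;> linarith
    by_cases hr : ∃ d : Sym2 W, d.map f = e
    · obtain ⟨d, rfl⟩ := hr
      have hinj := Sym2.map.injective f.injective
      have h1 : pairWeight H f p (d.map f) = if d ∈ H.edgeSet then p else 1 - p := by
        have : ∀ d', Sym2.map f d' = Sym2.map f d ↔ d' = d := fun d' => hinj.eq_iff
        simp only [pairWeight, this, forall_eq]
        by_cases hd : d ∈ H.edgeSet <;> simp [hd]
      rw [h1]
      by_cases hd : d ∈ H.edgeSet
      · rw [if_pos hd]
        refine hprod.trans (le_of_eq (if_pos ?_))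
        exact Finset.mem_image_of_mem _ (by simpa using hd)
      · rw [if_neg hd]
        refine hprod'.trans (le_of_eq (if_pos ?_))
        refine Finset.mem_image_of_mem _ ?_
        induction d with | _ x y =>
        simp only [Sym2.map_mk, SimpleGraph.mem_edgeFinset, SimpleGraph.mem_edgeSet,
          SimpleGraph.top_adj] at he ⊢
        exact fun h => he (by rw [h])
    · push Not at hr
      have h1 : pairWeight H f p e = 1 := by
        simp [pairWeight, hr]
      rw [h1]
      refine hprod.trans ?_
      split_ifs <;> linarith
  refine le_trans ?_ (Finset.prod_le_prod ?_ hle)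
  · rw [Finset.prod_mul_distrib, Finset.prod_ite, Finset.prod_ite]
    simp only [Finset.prod_const, one_pow, mul_one]
    refine mul_le_mul (pow_le_pow_of_le_one hp0 hp1 (le_trans (Finset.card_le_card ?_) hXc))
      (pow_le_pow_of_le_one hq0 hq1 (le_trans (Finset.card_le_card ?_) hYc)) (by positivity)
      (by positivity)
    · intro e he
      exact (Finset.mem_filter.1 he).2
    · intro e he
      exact (Finset.mem_filter.1 he).2
  · intro e _
    apply mul_nonneg <;> split_ifs <;> linarith

open scoped Classical in
theorem card_dominating_maps_le {n : ℕ} {W : Type} [Fintype W] (H : SimpleGraph W)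
    (G : SimpleGraph (Fin n)) {B : ℕ} (hB : Nat.card (H ≃g H) ≤ B) :
    (Finset.univ.filter fun f : W ↪ Fin n =>
      IsInducedMap H G f ∧ ∀ v ∉ Set.range f, ∃ u, G.Adj v (f u)).card ≤
    B * Nat.card {s : Set (Fin n) // IsInducedCopy H G s ∧ ∀ v ∉ s, ∃ u ∈ s, G.Adj v u} := by
  rw [Nat.card_eq_fintype_card, Fintype.card_subtype]
  refine Finset.card_le_mul_card_image_of_maps_to (f := fun f : W ↪ Fin n => Set.range f) ?_ _ ?_
  · intro f hf
    obtain ⟨hI, hD⟩ := (Finset.mem_filter.1 hf).2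
    refine Finset.mem_filter.2 ⟨Finset.mem_univ _, ⟨⟨Equiv.ofInjective f f.injective, ?_⟩⟩, ?_⟩
    · intro a b
      exact hI a b
    · intro v hv
      obtain ⟨u, hu⟩ := hD v hv
      exact ⟨f u, ⟨u, rfl⟩, hu⟩
  · intro s _
    set F := ((Finset.univ : Finset (W ↪ Fin n)).filter fun f : W ↪ Fin n =>
      IsInducedMap H G f ∧ ∀ v ∉ Set.range f, ∃ u, G.Adj v (f u)).filter
        (fun f : W ↪ Fin n => Set.range f = s) with hF
    have hmem : ∀ f ∈ F, IsInducedMap H G f ∧ Set.range f = s := by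
      intro f hf
      rw [hF, Finset.mem_filter, Finset.mem_filter] at hf
      exact ⟨hf.1.2.1, hf.2⟩
    rcases F.eq_empty_or_nonempty with h0 | ⟨f₀, hf₀⟩
    · rw [h0]; simp
    refine le_trans ?_ hB
    have hiso : ∀ f : F, ∃ σ : H ≃g H, ∀ w, f₀ (σ w) = f.1 w := by
      rintro ⟨f, hf⟩
      obtain ⟨hI0, hR0⟩ := hmem f₀ hf₀
      obtain ⟨hI, hR⟩ := hmem f hf
      let σ : W ≃ W := (Equiv.ofInjective f f.injective).trans
        ((Equiv.setCongr (hR.trans hR0.symm)).trans (Equiv.ofInjective f₀ f₀.injective).symm)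
      have hσ : ∀ w, f₀ (σ w) = f w := by
        intro w
        have := Equiv.apply_ofInjective_symm f₀.injective
          (Equiv.setCongr (hR.trans hR0.symm) (Equiv.ofInjective f f.injective w))
        exact this
      refine ⟨⟨σ, ?_⟩, hσ⟩
      intro a b
      rw [← hI0, hσ, hσ]
      exact hI a b
    choose g hg using hiso
    have : Finite (H ≃g H) := Finite.of_injective (fun σ => (σ : W → W)) DFunLike.coe_injective
    rw [← Fintype.card_coe, ← Nat.card_eq_fintype_card]
    refine Nat.card_le_card_of_injective g fun f f' h => ?_
    ext w
    rw [← hg f, ← hg f', h]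

open scoped Classical in
theorem le_mul_expec_copies {n : ℕ} {W : Type} [Fintype W] (H : SimpleGraph W) {p : ℝ}
    (hp0 : 0 ≤ p) (hp1 : p ≤ 1) {m B : ℕ} (hm : H.edgeFinset.card ≤ m)
    (hB : Nat.card (H ≃g H) ≤ B) :
    (n.descFactorial (Fintype.card W) : ℝ) * (p ^ m * (1 - p) ^ (Fintype.card W).choose 2 *
      (1 - (1 - p) ^ Fintype.card W) ^ (n - Fintype.card W)) ≤
    B * expec n p fun G => (Nat.card {s : Set (Fin n) //
      IsInducedCopy H G s ∧ ∀ v ∉ s, ∃ u ∈ s, G.Adj v u} : ℝ) := by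
  have hq0 : 0 ≤ 1 - p := by linarith
  have hq1 : 1 - p ≤ 1 := by linarith
  have hpow : (1 - p) ^ Fintype.card W ≤ 1 := pow_le_one₀ hq0 hq1
  have h1 : ∀ f : W ↪ Fin n, p ^ m * (1 - p) ^ (Fintype.card W).choose 2 *
      (1 - (1 - p) ^ Fintype.card W) ^ (n - Fintype.card W) ≤
      ∑ G : SimpleGraph (Fin n),
      (if IsInducedMap H G f ∧ ∀ v ∉ Set.range f, ∃ u, G.Adj v (f u) then (1 : ℝ) else 0) *
        (p ^ edgeCt G * (1 - p) ^ (n * (n - 1) / 2 - edgeCt G)) := by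
    intro f
    rw [sum_graph_induced_dominating]
    exact mul_le_mul_of_nonneg_right (le_prod_pairWeight H f hp0 hp1 hm)
      (pow_nonneg (by linarith) _)
  have h2 := Finset.sum_le_sum fun f (_ : f ∈ (Finset.univ : Finset (W ↪ Fin n))) => h1 f
  rw [Finset.sum_const, Finset.card_univ, Fintype.card_embedding_eq, Fintype.card_fin,
    nsmul_eq_mul, Finset.sum_comm] at h2
  refine h2.trans ?_
  rw [expec, Finset.mul_sum]
  refine Finset.sum_le_sum fun G _ => ?_
  rw [← Finset.sum_mul, ← mul_assoc (B : ℝ)]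
  refine mul_le_mul_of_nonneg_right ?_ (mul_nonneg (pow_nonneg hp0 _) (pow_nonneg hq0 _))
  rw [Finset.sum_boole]
  exact_mod_cast card_dominating_maps_le H G hB

theorem WG_adj_inl_inl {γ a : ℕ} (u v : Fin a) :
    (WG γ a).Adj (Sum.inl u) (Sum.inl v) ↔ (v : ℕ) = u + 1 ∨ (u : ℕ) = v + 1 := by
  simp only [WG, SimpleGraph.fromRel_adj, Wbase, ne_eq, Sum.inl.injEq, Fin.ext_iff]
  omega

theorem WG_adj_inr_inr {γ a : ℕ} {i j : Fin (ωr 4 a)} {k l : Fin (γ + 1)}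
    (h : (WG γ a).Adj (Sum.inr (i, k)) (Sum.inr (j, l))) :
    (i = j ∧ ((l : ℕ) = k + 1 ∨ (k : ℕ) = l + 1)) ∨
    ((k : ℕ) = 0 ∧ (l : ℕ) = 0 ∧
      ((1 ≤ (i : ℕ) ∧ (j : ℕ) = (i - 1) / 4) ∨ (1 ≤ (j : ℕ) ∧ (i : ℕ) = (j - 1) / 4))) := by
  simp only [WG, SimpleGraph.fromRel_adj, Wbase] at h
  rcases h.2 with (h | h) | (h | h)
  · exact Or.inl ⟨h.1, Or.inl h.2⟩
  · exact Or.inr ⟨h.1, h.2.1, Or.inl h.2.2⟩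
  · exact Or.inl ⟨h.1.symm, Or.inr h.2⟩
  · exact Or.inr ⟨h.2.1, h.1, Or.inr h.2.2⟩

theorem WG_adj_inr_inl {γ a : ℕ} {i : Fin (ωr 4 a)} {k : Fin (γ + 1)} {u : Fin a}
    (h : (WG γ a).Adj (Sum.inr (i, k)) (Sum.inl u)) :
    (k : ℕ) = γ ∧ heapDepth 4 (i : ℕ) = u := by
  simpa [WG, SimpleGraph.fromRel_adj, Wbase] using h

open scoped Classical in
theorem card_edgeFinset_WG_le (γ a : ℕ) :
    (WG γ a).edgeFinset.card ≤ a + (γ + 2) * ωr 4 a := by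
  let g : Fin a ⊕ ((Fin (ωr 4 a) × Fin (γ + 1)) ⊕ Fin (ωr 4 a)) → Sym2 (WVert γ a)
    | .inl u => if h : (u : ℕ) + 1 < a then s(.inl u, .inl ⟨u + 1, h⟩) else s(.inl u, .inl u)
    | .inr (.inl (i, k)) =>
        if (k : ℕ) = 0 then s(.inr (i, k), .inr (⟨((i : ℕ) - 1) / 4, by omega⟩, k))
        else s(.inr (i, k), .inr (i, ⟨(k : ℕ) - 1, by omega⟩))
    | .inr (.inr i) =>
        if h : heapDepth 4 (i : ℕ) < a then
          s(.inr (i, ⟨γ, Nat.lt_succ_self γ⟩), .inl ⟨heapDepth 4 (i : ℕ), h⟩)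
        else s(.inr (i, ⟨γ, Nat.lt_succ_self γ⟩), .inr (i, ⟨γ, Nat.lt_succ_self γ⟩))
  have hll : ∀ u v : Fin a, (v : ℕ) = u + 1 → ∃ x, g x = s(.inl u, .inl v) := by
    intro u v h
    refine ⟨.inl u, ?_⟩
    have hu : (u : ℕ) + 1 < a := by omega
    have hv : v = ⟨u + 1, hu⟩ := Fin.ext h
    simp only [g, dif_pos hu, hv]
  have hrl : ∀ (i : Fin (ωr 4 a)) (k : Fin (γ + 1)) (u : Fin a),
      (WG γ a).Adj (.inr (i, k)) (.inl u) → ∃ x, g x = s(.inr (i, k), .inl u) := by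
    intro i k u h
    obtain ⟨h1, h2⟩ := WG_adj_inr_inl h
    refine ⟨.inr (.inr i), ?_⟩
    have hu : heapDepth 4 (i : ℕ) < a := by omega
    have hv : u = ⟨heapDepth 4 (i : ℕ), hu⟩ := Fin.ext h2.symm
    have hk : k = ⟨γ, Nat.lt_succ_self γ⟩ := Fin.ext h1
    simp only [g, dif_pos hu, hv, hk]
  have hrr1 : ∀ (i : Fin (ωr 4 a)) (k l : Fin (γ + 1)), (k : ℕ) = l + 1 →
      ∃ x, g x = s(.inr (i, k), .inr (i, l)) := by
    intro i k l h
    refine ⟨.inr (.inl (i, k)), ?_⟩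
    have hk : (k : ℕ) ≠ 0 := by omega
    have hl : l = ⟨(k : ℕ) - 1, by omega⟩ := Fin.ext (by simp; omega)
    simp only [g, if_neg hk, ← hl]
  have hrr2 : ∀ (i j : Fin (ωr 4 a)) (k l : Fin (γ + 1)), (k : ℕ) = 0 → (l : ℕ) = 0 →
      (j : ℕ) = (i - 1) / 4 → ∃ x, g x = s(.inr (i, k), .inr (j, l)) := by
    intro i j k l hk hl h
    refine ⟨.inr (.inl (i, k)), ?_⟩
    have hl : l = k := Fin.ext (by omega)
    have hj : j = ⟨((i : ℕ) - 1) / 4, by omega⟩ := Fin.ext h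
    simp only [g, if_pos hk, hj, hl]
  have hsub : (WG γ a).edgeFinset ⊆ Finset.univ.image g := by
    intro e he
    simp only [Finset.mem_image, Finset.mem_univ, true_and]
    rw [SimpleGraph.mem_edgeFinset] at he
    induction e with | _ x y =>
    rw [SimpleGraph.mem_edgeSet] at he
    rcases x with u | ⟨i, k⟩ <;> rcases y with v | ⟨j, l⟩
    · rcases (WG_adj_inl_inl u v).1 he with h | h
      · exact hll u v h
      · rw [Sym2.eq_swap]
        exact hll v u h
    · rw [Sym2.eq_swap]
      exact hrl j l u he.symm
    · exact hrl i k v he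
    · rcases WG_adj_inr_inr he with ⟨rfl, h | h⟩ | ⟨hk, hl, h | h⟩
      · rw [Sym2.eq_swap]
        exact hrr1 i l k h
      · exact hrr1 i k l h
      · exact hrr2 i j k l hk hl h.2
      · rw [Sym2.eq_swap]
        exact hrr2 j i l k hl hk h.2
  refine (Finset.card_le_card hsub).trans (Finset.card_image_le.trans (le_of_eq ?_))
  simp only [Finset.card_univ, Fintype.card_sum, Fintype.card_prod, Fintype.card_fin]
  ring

/-- The neighbours of a vertex of `W_a^γ` outside `F₁` can be told apart by eight labels. -/
theorem exists_injOn_neighborSet_WG {γ a : ℕ} (i : Fin (ωr 4 a)) (k : Fin (γ + 1)) :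
    ∃ l : WVert γ a → Fin 8, Set.InjOn l ((WG γ a).neighborSet (Sum.inr (i, k))) := by
  let c : WVert γ a → ℕ
    | .inl _ => 0
    | .inr (j, m) => if j = i then (if (m : ℕ) = k + 1 then 1 else 2)
        else if (j : ℕ) < i then 3 else (j : ℕ) - 4 * i + 3
  have hc : ∀ x ∈ (WG γ a).neighborSet (Sum.inr (i, k)), c x < 8 := by
    rintro (u | ⟨j, m⟩) hx
    · simp [c]
    · rw [SimpleGraph.mem_neighborSet] at hx
      have := WG_adj_inr_inr hx
      simp only [c, Fin.ext_iff] at this ⊢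
      split_ifs <;> omega
  refine ⟨fun x => if h : c x < 8 then ⟨c x, h⟩ else 0, ?_⟩
  intro x hx y hy h
  simp only [dif_pos (hc x hx), dif_pos (hc y hy), Fin.mk.injEq] at h
  rw [SimpleGraph.mem_neighborSet] at hx hy
  rcases x with u | ⟨j, m⟩ <;> rcases y with v | ⟨j', m'⟩
  · have h1 := WG_adj_inr_inl hx
    have h2 := WG_adj_inr_inl hy
    exact congrArg _ (Fin.ext (by omega))
  · simp only [c] at h
    split_ifs at h
  · simp only [c] at h
    split_ifs at h
  · have h1 := WG_adj_inr_inr hx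
    have h2 := WG_adj_inr_inr hy
    simp only [c, Fin.ext_iff] at h h1 h2
    simp only [Sum.inr.injEq, Prod.mk.injEq, Fin.ext_iff]
    split_ifs at h <;> omega

theorem WG_adj_succ {γ a : ℕ} (i : Fin (ωr 4 a)) (k l : Fin (γ + 1)) (h : (l : ℕ) = k + 1) :
    (WG γ a).Adj (Sum.inr (i, k)) (Sum.inr (i, l)) := by
  refine (SimpleGraph.fromRel_adj _ _ _).2 ⟨fun h' => ?_, Or.inl (Or.inl ⟨rfl, h⟩)⟩
  simp only [Sum.inr.injEq, Prod.mk.injEq, Fin.ext_iff] at h'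
  omega

theorem WG_adj_parent {γ a : ℕ} (i j : Fin (ωr 4 a)) (k : Fin (γ + 1)) (hk : (k : ℕ) = 0)
    (hi : 1 ≤ (i : ℕ)) (hj : (j : ℕ) = (i - 1) / 4) :
    (WG γ a).Adj (Sum.inr (j, k)) (Sum.inr (i, k)) := by
  simp only [WG, SimpleGraph.fromRel_adj, Wbase, ne_eq, Sum.inr.injEq, Prod.mk.injEq,
    Fin.ext_iff]
  omega

theorem three_mul_ωr_four (a : ℕ) : 3 * ωr 4 a + 1 = 4 ^ a := by
  have h : (4 - 1) ∣ 4 ^ a - 1 := by simpa using Nat.sub_dvd_pow_sub_pow 4 1 a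
  have h1 : 1 ≤ 4 ^ a := Nat.one_le_pow _ _ (by norm_num)
  have h2 : 3 * ωr 4 a = 4 ^ a - 1 := Nat.mul_div_cancel' h
  omega

theorem ωr_four_pos {a : ℕ} (ha : 1 ≤ a) : 0 < ωr 4 a := by
  have h1 := three_mul_ωr_four a
  have h2 : 4 ^ 1 ≤ 4 ^ a := Nat.pow_le_pow_right (by norm_num) ha
  omega

open scoped Classical in
theorem card_aut_WG_le (γ : ℕ) {a : ℕ} (ha : 1 ≤ a) :
    Nat.card (WG γ a ≃g WG γ a) ≤
      Fintype.card (WVert γ a) ^ (a + 1) * 8 ^ Fintype.card (WVert γ a) := by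
  have hpos := ωr_four_pos ha
  have hlab : ∀ x : WVert γ a, ∃ l : WVert γ a → Fin 8,
      ∀ (σ : WG γ a ≃g WG γ a) (ik : Fin (ωr 4 a) × Fin (γ + 1)), σ (Sum.inr ik) = x →
      Set.InjOn l ((WG γ a).neighborSet x) := by
    intro x
    by_cases h : ∃ (σ : WG γ a ≃g WG γ a) (ik : Fin (ωr 4 a) × Fin (γ + 1)), σ (Sum.inr ik) = x
    · obtain ⟨σ, ⟨i, k⟩, rfl⟩ := h
      obtain ⟨l, hl⟩ := exists_injOn_neighborSet_WG i k
      refine ⟨fun y => l (σ.symm y), fun _ _ _ y hy z hz hyz => ?_⟩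
      apply σ.symm.injective
      refine hl ?_ ?_ hyz
      · rw [SimpleGraph.mem_neighborSet] at hy ⊢
        rw [← σ.map_adj_iff]
        simpa using hy
      · rw [SimpleGraph.mem_neighborSet] at hz ⊢
        rw [← σ.map_adj_iff]
        simpa using hz
    · exact ⟨fun _ => 0, fun σ ik hσ => absurd ⟨σ, ik, hσ⟩ h⟩
  choose l hl using hlab
  let par : WVert γ a → WVert γ a
    | .inl u => .inl u
    | .inr (i, k) => if (k : ℕ) = 0 then .inr (⟨((i : ℕ) - 1) / 4, by omega⟩, k)
        else .inr (i, ⟨(k : ℕ) - 1, by omega⟩)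
  let code : (WG γ a ≃g WG γ a) →
      ((Option (Fin a) → WVert γ a) × (WVert γ a → Fin 8)) := fun σ =>
    (fun o => match o with
      | some u => σ (.inl u)
      | none => σ (.inr (⟨0, hpos⟩, 0)),
     fun x => l (σ (par x)) (σ x))
  have hcode : Function.Injective code := by
    intro σ τ h
    have h1 : ∀ o, (code σ).1 o = (code τ).1 o := fun o => by rw [h]
    have h2 : ∀ x, l (σ (par x)) (σ x) = l (τ (par x)) (τ x) := fun x =>
      congrFun (congrArg Prod.snd h) x
    have hstep : ∀ ik x, par x = .inr ik → (WG γ a).Adj (.inr ik) x →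
        σ (.inr ik) = τ (.inr ik) → σ x = τ x := by
      intro ik x hx hadj heq
      have h3 := h2 x
      rw [hx, ← heq] at h3
      refine hl _ σ ik rfl ?_ ?_ h3
      · rw [SimpleGraph.mem_neighborSet, σ.map_adj_iff]
        exact hadj
      · rw [SimpleGraph.mem_neighborSet, heq, τ.map_adj_iff]
        exact hadj
    have hroot : ∀ (N : ℕ) (i : Fin (ωr 4 a)), (i : ℕ) = N → σ (.inr (i, 0)) = τ (.inr (i, 0)) := by
      intro N
      induction N using Nat.strong_induction_on with
      | _ N ih =>
        intro i hi
        rcases Nat.eq_zero_or_pos N with h0 | h0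
        · have hi0 : i = ⟨0, hpos⟩ := Fin.ext (by simp; omega)
          rw [hi0]
          exact h1 none
        · refine hstep (⟨((i : ℕ) - 1) / 4, by omega⟩, 0) _ ?_ ?_ ?_
          · simp [par]
          · exact WG_adj_parent _ _ _ rfl (by omega) rfl
          · exact ih (((i : ℕ) - 1) / 4) (by omega) _ rfl
    have hall : ∀ (N : ℕ) (i : Fin (ωr 4 a)) (k : Fin (γ + 1)), (k : ℕ) = N →
        σ (.inr (i, k)) = τ (.inr (i, k)) := by
      intro N
      induction N with
      | zero =>
        intro i k hk
        have : k = 0 := Fin.ext hk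
        rw [this]
        exact hroot i i rfl
      | succ N ih =>
        intro i k hk
        refine hstep (i, ⟨(k : ℕ) - 1, by omega⟩) _ ?_ ?_ ?_
        · simp only [par]
          rw [if_neg (by omega)]
        · exact WG_adj_succ _ _ _ (by simp; omega)
        · exact ih _ _ (by simp; omega)
    ext x
    rcases x with u | ⟨i, k⟩
    · exact h1 (some u)
    · exact hall k i k rfl
  refine (Nat.card_le_card_of_injective code hcode).trans (le_of_eq ?_)
  rw [Nat.card_eq_fintype_card, Fintype.card_prod, Fintype.card_fun, Fintype.card_fun,
    Fintype.card_option, Fintype.card_fin, Fintype.card_fin]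

theorem exp_neg_add_sq_le_one_sub {p : ℝ} (h0 : 0 ≤ p) (h1 : p ≤ 1 / 2) :
    Real.exp (-(p + 2 * p ^ 2)) ≤ 1 - p := by
  have hy : 0 < 1 + (p + 2 * p ^ 2) := by positivity
  rw [Real.exp_neg]
  refine (inv_anti₀ hy (by linarith [Real.add_one_le_exp (p + 2 * p ^ 2)])).trans ?_
  rw [inv_le_iff_one_le_mul₀ hy]
  nlinarith [mul_nonneg (sq_nonneg p) (by linarith : (0 : ℝ) ≤ 1 - 2 * p)]

theorem exp_le_descFactorial {N V : ℕ} (hN : 0 < N) (h : 2 * V ≤ N) :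
    Real.exp (V * (Real.log N - Real.log 2)) ≤ (N.descFactorial V : ℝ) := by
  have hN' : (0 : ℝ) < N := by exact_mod_cast hN
  have h1 : ((N + 1 - V : ℕ) : ℝ) ^ V ≤ (N.descFactorial V : ℝ) := by
    exact_mod_cast Nat.pow_sub_le_descFactorial N V
  have h2 : (N : ℝ) / 2 ≤ ((N + 1 - V : ℕ) : ℝ) := by
    rw [div_le_iff₀ (by norm_num)]
    have : N ≤ (N + 1 - V) * 2 := by omega
    exact_mod_cast this
  refine le_trans ?_ h1
  rw [Real.exp_nat_mul, ← Real.log_div hN'.ne' (by norm_num), Real.exp_log (by positivity)]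
  gcongr

theorem exp_le_one_sub_pow_choose {p D : ℝ} (h0 : 0 ≤ p) (h1 : p ≤ 1 / 2) (V : ℕ)
    (hD : V * (p + 2 * p ^ 2) ≤ D) :
    Real.exp (-(V * (D / 2))) ≤ (1 - p) ^ V.choose 2 := by
  refine le_trans ?_ (pow_le_pow_left₀ (Real.exp_pos _).le (exp_neg_add_sq_le_one_sub h0 h1) _)
  rw [← Real.exp_nat_mul, Real.exp_le_exp, mul_neg, neg_le_neg_iff, Nat.cast_choose_two]
  have hV : (0 : ℝ) ≤ V := Nat.cast_nonneg V
  have hs : 0 ≤ p + 2 * p ^ 2 := by positivity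
  nlinarith [mul_le_mul_of_nonneg_left hD hV, mul_nonneg hV hs]

theorem exp_le_one_sub_pow_pow {p s E : ℝ} (h1 : p ≤ 1) (N V : ℕ)
    (hs : s ≤ p * V) (hs2 : Real.exp (-s) ≤ 1 / 2) (hE : 2 * (N * Real.exp (-s)) ≤ V * E) :
    Real.exp (-(V * E)) ≤ (1 - (1 - p) ^ V) ^ (N - V) := by
  set q := (1 - p) ^ V with hq
  have hq0 : 0 ≤ q := pow_nonneg (by linarith) _
  have hqs : q ≤ Real.exp (-s) := by
    have h2 : 1 - p ≤ Real.exp (-p) := by linarith [Real.add_one_le_exp (-p)]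
    refine (pow_le_pow_left₀ (by linarith) h2 V).trans ?_
    rw [← Real.exp_nat_mul, Real.exp_le_exp]
    linarith
  have hq2 : q ≤ 1 / 2 := hqs.trans hs2
  have h3 : Real.exp (-(2 * q)) ≤ 1 - q := by
    refine le_trans ?_ (exp_neg_add_sq_le_one_sub hq0 hq2)
    rw [Real.exp_le_exp]
    nlinarith
  refine le_trans ?_ (pow_le_pow_of_le_one (by linarith) (by linarith) (Nat.sub_le N V))
  refine le_trans ?_ (pow_le_pow_left₀ (Real.exp_pos _).le h3 N)
  rw [← Real.exp_nat_mul, Real.exp_le_exp]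
  have : (N : ℝ) * q ≤ N * Real.exp (-s) := mul_le_mul_of_nonneg_left hqs (Nat.cast_nonneg N)
  linarith

theorem pow_succ_le_exp {a V : ℕ} (hV : 1 ≤ V) (h : 4 ^ a ≤ 4 * V) :
    (V : ℝ) ^ (a + 1) ≤ Real.exp (V * 4) := by
  have hV' : (1 : ℝ) ≤ V := by exact_mod_cast hV
  have hs : 0 < √(V : ℝ) := Real.sqrt_pos.2 (by linarith)
  have hsq : √(V : ℝ) ^ 2 = V := Real.sq_sqrt (by linarith)
  have h1 : Real.log V ≤ 2 * √(V : ℝ) := by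
    rw [← hsq, Real.log_pow, hsq]
    push_cast
    linarith [Real.log_le_sub_one_of_pos hs]
  have h2 : (2 : ℝ) ^ a ≤ 2 * √(V : ℝ) := by
    refine le_of_sq_le_sq ?_ (by positivity)
    rw [mul_pow, hsq, ← pow_mul, mul_comm a, pow_mul]
    norm_num
    exact_mod_cast h
  have h3 : ((a + 1 : ℕ) : ℝ) ≤ 2 ^ a := by exact_mod_cast Nat.lt_two_pow_self (n := a)
  calc (V : ℝ) ^ (a + 1) = Real.exp (((a + 1 : ℕ) : ℝ) * Real.log V) := by
        rw [Real.exp_nat_mul, Real.exp_log (by linarith)]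
    _ ≤ Real.exp (V * 4) := by
        rw [Real.exp_le_exp]
        calc ((a + 1 : ℕ) : ℝ) * Real.log V ≤ (2 * √(V : ℝ)) * (2 * √(V : ℝ)) :=
              mul_le_mul (h3.trans h2) h1 (Real.log_nonneg hV') (by positivity)
          _ = V * 4 := by linear_combination 4 * hsq

theorem kcoef_pos {α : ℝ} (hα : α < 1 / 2) (γ : ℕ) : 0 < kcoef α γ := by
  have hγ : (0 : ℝ) ≤ γ := Nat.cast_nonneg γ
  have h : α * ((γ : ℝ) + 2) / ((γ : ℝ) + 1) < 1 := by
    rw [div_lt_one (by positivity)]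
    nlinarith
  rw [kcoef]
  linarith

/-- The first moment estimate, with all the requirements on the size of `N` made explicit. -/
theorem first_moment_lower_bound {α C₁ C₂ : ℝ} (hα0 : 0 < α) (γ : ℕ)
    (hk : 0 < kcoef α γ) (hC1 : 1 - α ≤ C₁ * kcoef α γ) (hC1' : 0 < C₁)
    {N a V ω m : ℕ} (hV : V = a + (γ + 1) * ω) (hω : 3 * ω + 1 = 4 ^ a)
    (hm : m = a + (γ + 2) * ω) (hVpos : 1 ≤ V)
    (hVl : C₁ * kcoef α γ * ff α N ≤ V) (hVu : V ≤ C₂ * kcoef α γ * ff α N)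
    (hN : 1 ≤ N) (hL : 1 ≤ Real.log N) (hp : (N : ℝ) ^ (-α) ≤ 1 / 2)
    (hLp : Real.log N * (N : ℝ) ^ (-α) ≤ 1)
    (hVN : 2 * V ≤ N) (hs : Real.exp (-(C₁ * kcoef α γ * Real.log N)) ≤ 1 / 2) :
    ((V : ℝ) ^ (a + 1) * 8 ^ V) * Real.exp (V * (kcoef α γ / 2 * (1 - C₂) * Real.log N -
      (Real.log 2 + C₂ * kcoef α γ + 2 / (C₁ * kcoef α γ) + 4 + Real.log 8))) ≤
    (N.descFactorial V : ℝ) * (((N : ℝ) ^ (-α)) ^ m * (1 - (N : ℝ) ^ (-α)) ^ V.choose 2 *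
      (1 - (1 - (N : ℝ) ^ (-α)) ^ V) ^ (N - V)) := by
  have hN0 : (0 : ℝ) < N := by exact_mod_cast hN
  have hV1 : (1 : ℝ) ≤ V := by exact_mod_cast hVpos
  set k := kcoef α γ with hkdef
  set L := Real.log N with hLdef
  set p := (N : ℝ) ^ (-α) with hpdef
  set x := (N : ℝ) ^ α with hxdef
  have hx : 0 < x := Real.rpow_pos_of_pos hN0 _
  have hp0 : 0 < p := Real.rpow_pos_of_pos hN0 _
  have hxp : x * p = 1 := by
    rw [hxdef, hpdef, ← Real.rpow_add hN0]
    simp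
  have hff : ff α N = x * L := rfl
  rw [hff] at hVl hVu
  have hCk : 0 < C₁ * k := by positivity
  have hC2k : 0 < C₂ * k := by
    by_contra hneg
    have : C₂ * k * (x * L) ≤ 0 := mul_nonpos_of_nonpos_of_nonneg (by linarith) (by positivity)
    linarith
  have hpV : V * p ≤ C₂ * k * L := by
    calc V * p ≤ C₂ * k * (x * L) * p := mul_le_mul_of_nonneg_right hVu hp0.le
      _ = C₂ * k * L * (x * p) := by ring
      _ = C₂ * k * L := by rw [hxp, mul_one]
  have hpVl : C₁ * k * L ≤ p * V := by
    calc C₁ * k * L = C₁ * k * L * (x * p) := by rw [hxp, mul_one]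
      _ = p * (C₁ * k * (x * L)) := by ring
      _ ≤ p * V := mul_le_mul_of_nonneg_left hVl hp0.le
  have hpm : Real.exp (-(V * (α * ((γ : ℝ) + 2) / ((γ : ℝ) + 1) * L))) ≤ p ^ m := by
    rw [hpdef, Real.rpow_def_of_pos hN0, ← Real.exp_nat_mul, Real.exp_le_exp]
    have hγ : (0 : ℝ) < (γ : ℝ) + 1 := by positivity
    have hmV : (m : ℝ) ≤ V * (((γ : ℝ) + 2) / ((γ : ℝ) + 1)) := by
      rw [mul_div_assoc', le_div_iff₀ hγ, hm, hV]
      push_cast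
      nlinarith [(Nat.cast_nonneg a : (0 : ℝ) ≤ a)]
    have := mul_le_mul_of_nonneg_right hmV (by positivity : 0 ≤ α * L)
    have e : V * (α * ((γ : ℝ) + 2) / ((γ : ℝ) + 1) * L) =
      V * (((γ : ℝ) + 2) / ((γ : ℝ) + 1)) * (α * L) := by ring
    rw [e]
    linarith
  have hD : V * (p + 2 * p ^ 2) ≤ C₂ * k * L + 2 * (C₂ * k) := by
    have h1 : V * p * p ≤ C₂ * k * L * p := mul_le_mul_of_nonneg_right hpV hp0.le
    have h2 : C₂ * k * (L * p) ≤ C₂ * k * 1 := mul_le_mul_of_nonneg_left hLp hC2k.le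
    nlinarith
  have hE : 2 * (N * Real.exp (-(C₁ * k * L))) ≤ V * (2 / (C₁ * k)) := by
    have h1 : N * Real.exp (-(C₁ * k * L)) ≤ x := by
      rw [hxdef, Real.rpow_def_of_pos hN0]
      nth_rewrite 1 [← Real.exp_log hN0]
      rw [← Real.exp_add, Real.exp_le_exp]
      nlinarith
    have h2 : x ≤ V / (C₁ * k) := by
      rw [le_div_iff₀ hCk]
      nlinarith [mul_le_mul_of_nonneg_left hL (by positivity : 0 ≤ C₁ * k * x)]
    calc 2 * (N * Real.exp (-(C₁ * k * L))) ≤ 2 * (V / (C₁ * k)) := by linarith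
      _ = V * (2 / (C₁ * k)) := by ring
  have h4a : 4 ^ a ≤ 4 * V := by
    have : ω ≤ (γ + 1) * ω := Nat.le_mul_of_pos_left _ (Nat.succ_pos γ)
    omega
  have h8 : (8 : ℝ) ^ V = Real.exp (V * Real.log 8) := by
    rw [Real.exp_nat_mul, Real.exp_log (by norm_num)]
  have hB : (V : ℝ) ^ (a + 1) * 8 ^ V ≤ Real.exp (V * 4) * Real.exp (V * Real.log 8) := by
    rw [h8]
    exact mul_le_mul_of_nonneg_right (pow_succ_le_exp hVpos h4a) (Real.exp_pos _).le
  refine (mul_le_mul_of_nonneg_right hB (Real.exp_pos _).le).trans ?_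
  have key := mul_le_mul (exp_le_descFactorial hN hVN)
    (mul_le_mul (mul_le_mul hpm (exp_le_one_sub_pow_choose hp0.le hp V hD) (Real.exp_pos _).le
      (by positivity)) (exp_le_one_sub_pow_pow (by linarith) N V hpVl hs hE) (Real.exp_pos _).le
      (mul_nonneg (by positivity) (pow_nonneg (by linarith) _))) (by positivity) (by positivity)
  refine le_trans (le_of_eq ?_) key
  simp only [← Real.exp_add]
  congr 1
  have hk2 : α * ((γ : ℝ) + 2) / ((γ : ℝ) + 1) = 1 - k / 2 := by
    rw [hkdef, kcoef]
    ring
  rw [hk2]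
  ring

/-- Let α ∈ (0,1/2), γ > (3α−1)/(1−2α), (1−α)/k_γ < C₁ < C₂ < 1, and let
(n_i) be a strictly increasing sequence of positive integers with integers a_i ≥ 1
satisfying C₁·k_γ·f(n_i) ≤ a_i + (γ+1)(4^{a_i}−1)/3 ≤ C₂·k_γ·f(n_i). Then
E[W̃(a_i)(G(n_i, n_i^{−α}))] → ∞. -/
theorem stmt10 (α : ℝ) (hα0 : 0 < α) (hα : α < 1 / 2) (γ : ℕ)
    (hγ : (γ : ℝ) > (3 * α - 1) / (1 - 2 * α))
    (C₁ C₂ : ℝ) (hC1 : (1 - α) / kcoef α γ < C₁) (hC12 : C₁ < C₂) (hC2 : C₂ < 1)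
    (n : ℕ → ℕ) (hmono : StrictMono n) (hpos : ∀ i, 0 < n i)
    (a : ℕ → ℕ) (ha1 : ∀ i, 1 ≤ a i)
    (ha : ∀ i,
        C₁ * kcoef α γ * ff α (n i) ≤ (a i : ℝ) + ((γ : ℝ) + 1) * ((4 : ℝ) ^ a i - 1) / 3 ∧
        (a i : ℝ) + ((γ : ℝ) + 1) * ((4 : ℝ) ^ a i - 1) / 3 ≤ C₂ * kcoef α γ * ff α (n i)) :
    Tendsto (fun i : ℕ =>
        expec (n i) ((n i : ℝ) ^ (-α)) (fun G => (maxCopyCount γ (a i) G : ℝ)))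
      atTop atTop := by
  have hk := kcoef_pos hα γ
  have hC1' : 0 < C₁ := (div_pos (by linarith) hk).trans hC1
  have hC1k : 1 - α ≤ C₁ * kcoef α γ := ((div_lt_iff₀ hk).1 hC1).le
  have hC2' : 0 < C₂ := hC1'.trans hC12
  set c := kcoef α γ / 2 * (1 - C₂) with hc
  set K := Real.log 2 + C₂ * kcoef α γ + 2 / (C₁ * kcoef α γ) + 4 + Real.log 8 with hK
  have hcpos : 0 < c := mul_pos (by linarith) (by linarith)
  have hlog : Tendsto (fun i => Real.log (n i)) atTop atTop :=
    Real.tendsto_log_atTop.comp (tendsto_natCast_atTop_atTop.comp hmono.tendsto_atTop)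
  have hexp : Tendsto (fun i => c * Real.log (n i) - K) atTop atTop :=
    tendsto_atTop_add_const_right _ (-K) (hlog.const_mul_atTop hcpos)
  refine tendsto_atTop_mono' atTop ?_ hexp
  have hcast : Tendsto (fun i => (n i : ℝ)) atTop atTop :=
    tendsto_natCast_atTop_atTop.comp hmono.tendsto_atTop
  have hev1 := hcast.eventually
    ((isLittleO_log_rpow_atTop hα0).bound (by norm_num : (0 : ℝ) < 1))
  have hev2 := hcast.eventually
    ((isLittleO_log_rpow_atTop (by linarith : 0 < 1 - α)).bound
      (by positivity : (0 : ℝ) < 1 / (2 * (C₂ * kcoef α γ))))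
  have hev3 := hcast.eventually ((tendsto_rpow_neg_atTop hα0).eventually
    (ge_mem_nhds (by norm_num : (0 : ℝ) < 1 / 2)))
  have hev4 := hlog.eventually_ge_atTop (Real.log 2 / (C₁ * kcoef α γ))
  filter_upwards [hev1, hev2, hev3, hev4, hlog.eventually_ge_atTop 1,
    hexp.eventually_ge_atTop 0] with i h1 h2 h3 h4 h5 h6
  have hn0 : (0 : ℝ) < n i := by exact_mod_cast hpos i
  set N := n i with hN
  set V := Fintype.card (WVert γ (a i)) with hVdef
  have hV : V = a i + (γ + 1) * ωr 4 (a i) := by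
    rw [hVdef]
    simp only [Fintype.card_sum, Fintype.card_prod, Fintype.card_fin]
    ring
  have hω := three_mul_ωr_four (a i)
  have hVR : (V : ℝ) = (a i : ℝ) + ((γ : ℝ) + 1) * ((4 : ℝ) ^ a i - 1) / 3 := by
    have h : (3 : ℝ) * (ωr 4 (a i) : ℝ) + 1 = 4 ^ a i := by exact_mod_cast hω
    rw [hV, ← h]
    push_cast
    ring
  obtain ⟨hVl, hVu⟩ := ha i
  rw [← hVR] at hVl hVu
  have hVpos : 1 ≤ V := by
    rw [hV]
    exact (ha1 i).trans (Nat.le_add_right _ _)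
  have hx : 0 < (N : ℝ) ^ α := Real.rpow_pos_of_pos hn0 _
  have hp0 : 0 < (N : ℝ) ^ (-α) := Real.rpow_pos_of_pos hn0 _
  have hLp : Real.log N * (N : ℝ) ^ (-α) ≤ 1 := by
    rw [Real.norm_of_nonneg (by linarith), Real.norm_of_nonneg hx.le, one_mul] at h1
    calc Real.log N * (N : ℝ) ^ (-α) ≤ (N : ℝ) ^ α * (N : ℝ) ^ (-α) :=
          mul_le_mul_of_nonneg_right h1 hp0.le
      _ = 1 := by rw [← Real.rpow_add hn0]; simp
  have hVN : 2 * V ≤ N := by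
    have h7 : 0 < (N : ℝ) ^ (1 - α) := Real.rpow_pos_of_pos hn0 _
    rw [Real.norm_of_nonneg (by linarith), Real.norm_of_nonneg h7.le] at h2
    have h8 : (N : ℝ) ^ α * (N : ℝ) ^ (1 - α) = N := by
      rw [← Real.rpow_add hn0]
      simp
    have h9 : (2 : ℝ) * V ≤ N := by
      calc (2 : ℝ) * V ≤ 2 * (C₂ * kcoef α γ * ff α N) := by linarith
        _ = 2 * (C₂ * kcoef α γ) * (N : ℝ) ^ α * Real.log N := by rw [ff]; ring
        _ ≤ 2 * (C₂ * kcoef α γ) * (N : ℝ) ^ α *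
            (1 / (2 * (C₂ * kcoef α γ)) * (N : ℝ) ^ (1 - α)) :=
          mul_le_mul_of_nonneg_left h2 (by positivity)
        _ = (N : ℝ) ^ α * (N : ℝ) ^ (1 - α) := by field_simp
        _ = N := h8
    exact_mod_cast h9
  have hs : Real.exp (-(C₁ * kcoef α γ * Real.log N)) ≤ 1 / 2 := by
    rw [div_le_iff₀ (by positivity)] at h4
    rw [one_div, ← Real.exp_log (by norm_num : (0 : ℝ) < 2), ← Real.exp_neg, Real.exp_le_exp]
    linarith
  have hlower := first_moment_lower_bound (C₂ := C₂) hα0 γ hk hC1k hC1' hV hω rfl hVpos hVl hVu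
    (hpos i) h5 h3 hLp hVN hs
  have hupper := le_mul_expec_copies (n := N) (WG γ (a i)) hp0.le (by linarith)
    (card_edgeFinset_WG_le γ (a i)) (card_aut_WG_le γ (ha1 i))
  have hboth := hlower.trans hupper
  push_cast at hboth
  have hBpos : (0 : ℝ) < (V : ℝ) ^ (a i + 1) * 8 ^ V := by
    have : (0 : ℝ) < V := by exact_mod_cast hVpos
    positivity
  have hfin := le_of_mul_le_mul_left hboth hBpos
  refine le_trans ?_ hfin
  have hV1 : (1 : ℝ) ≤ V := by exact_mod_cast hVpos
  calc c * Real.log N - K ≤ V * (c * Real.log N - K) := le_mul_of_one_le_left h6 hV1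
    _ ≤ Real.exp (V * (c * Real.log N - K)) := by
      linarith [Real.add_one_le_exp (V * (c * Real.log N - K))]
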